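/- Work in ℝ² with SINR parameters N, T > 0 and an attenuation function l: ℝ₊ → ℝ₊ that is continuous, strictly decreasing, satisfies l ≤ 1, ∫₀^∞ x l(x) dx < ∞, and l(x) > 0 for all x ∈ ℝ₊. Let Φ be a stationary, ν-weakly sub-Poisson point process and let Φ_I be an α-weakly sub-Poisson point process of intensity μ for some μ > 0 (not necessarily independent of Φ). Then there exist a signal power P > 0 and an interference parameter γ > 0 such that the SINR graph G(Φ, Φ_I, γ) percolates (contains an infinite connected component) with positive probability. -/

import Mathlib

open MeasureTheory ENNReal Metric

noncomputable section

/-- The plane `ℝ²`. -/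
abbrev E2 := EuclideanSpace ℝ (Fin 2)

/-- The set of atoms (points) of a counting measure. -/
def atomsOf (μ : Measure E2) : Set E2 := {x | μ {x} ≠ 0}

/-- The SINR condition `SINR(x, y, μI, γ) > T`, i.e.
`P·l(|x−y|) > T(N + γ P I_{μI∖{x}}(y))`, where the interference
`I_{μI∖{x}}(y) = Σ_{X ∈ μI, X ∉ {x,y}} l(|X−y|)`. -/
def sinrGT (l : ℝ → ℝ) (pw Nz T γ : ℝ) (μI : Measure E2) (x y : E2) : Prop :=
  ENNReal.ofReal T *
      (ENNReal.ofReal Nz +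
        ENNReal.ofReal (γ * pw) * ∫⁻ z in ({x, y}ᶜ : Set E2), ENNReal.ofReal (l (dist z y)) ∂μI)
    < ENNReal.ofReal (pw * l (dist x y))

/-- Percolation (existence of an infinite connected subgraph) of the graph with
vertex set `V` and adjacency relation `A`. -/
def GraphPercolates (V : Set E2) (A : E2 → E2 → Prop) : Prop :=
  ∃ S : Set E2, S ⊆ V ∧ S.Infinite ∧
    ∀ x ∈ S, ∀ y ∈ S, Relation.ReflTransGen (fun a b => a ∈ S ∧ b ∈ S ∧ A a b) x y

/-- Nearest-neighbour adjacency on `ℤ²`. -/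
def LatticeAdj (a b : ℤ × ℤ) : Prop :=
  b = (a.1 + 1, a.2) ∨ b = (a.1 - 1, a.2) ∨ b = (a.1, a.2 + 1) ∨ b = (a.1, a.2 - 1)

/-- The graph on `ℤ²` joining distinct sites of `W` at sup-distance one. -/
def starGraph (W : Set (ℤ × ℤ)) : SimpleGraph (ℤ × ℤ) where
  Adj a b := a ≠ b ∧ a ∈ W ∧ b ∈ W ∧ |a.1 - b.1| ≤ 1 ∧ |a.2 - b.2| ≤ 1
  symm := ⟨fun a b ⟨h1, h2, h3, h4, h5⟩ =>
    ⟨h1.symm, h3, h2, by rwa [abs_sub_comm], by rwa [abs_sub_comm]⟩⟩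
  loopless := ⟨fun a h => h.1 rfl⟩

/-- A compactly supported closed `ZMod 2`-valued cochain on `ℤ²` (`cH`, `cV` being its values on
horizontal and vertical edges) has a compactly supported primitive. -/
lemma exists_primitive_of_closed (R : ℤ) (cH cV : ℤ → ℤ → ZMod 2)
    (hH : ∀ x y, cH x y ≠ 0 → |x| < R ∧ |y| < R) (hV : ∀ x y, cV x y ≠ 0 → |x| < R ∧ |y| < R)
    (hclosed : ∀ x y, cH x y + cV (x + 1) y = cV x y + cH x (y + 1)) :
    ∃ h : ℤ → ℤ → ZMod 2, (∀ x y, h (x + 1) y = h x y + cH x y) ∧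
      (∀ x y, h x (y + 1) = h x y + cV x y) ∧ (∀ x y, R < |x| → h x y = 0) := by
  have hH0 : ∀ x y, (R ≤ |x| ∨ R ≤ |y|) → cH x y = 0 := fun x y hxy => by
    by_contra hne
    have := hH x y hne
    omega
  have hV0 : ∀ x y, (R ≤ |x| ∨ R ≤ |y|) → cV x y = 0 := fun x y hxy => by
    by_contra hne
    have := hV x y hne
    omega
  set h : ℤ → ℤ → ZMod 2 := fun x y => ∑ u ∈ Finset.Ico (-R) x, cH u y with hh
  have hleft : ∀ x y, x ≤ -R → h x y = 0 := fun x y hx => by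
    simp [hh, Finset.Ico_eq_empty_of_le hx]
  have hx : ∀ x y, h (x + 1) y = h x y + cH x y := by
    intro x y
    rcases le_or_gt (-R) x with hx | hx
    · simp only [hh]
      rw [← Finset.insert_Ico_right_eq_Ico_add_one hx, Finset.sum_insert (by simp), add_comm]
    · rw [hleft _ _ (by omega), hleft _ _ hx.le, hH0 x y (Or.inl (by rw [le_abs]; omega))]
      simp
  have hy : ∀ x y, h x (y + 1) = h x y + cV x y := by
    intro x y
    rcases le_or_gt x (-R) with hx' | hx'
    · rw [hleft _ _ hx', hleft _ _ hx', hV0 x y (Or.inl (by rw [le_abs]; omega))]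
      simp
    · induction x, hx'.le using Int.leInduction with
      | base => exact absurd hx' (lt_irrefl _)
      | succ n hn ih =>
        have hn' : h n (y + 1) = h n y + cV n y := by
          rcases hn.eq_or_lt with rfl | hlt
          · rw [hleft _ _ le_rfl, hleft _ _ le_rfl, hV0 _ y (Or.inl (by rw [le_abs]; omega))]
            simp
          · exact ih hlt
        rw [hx, hx, hn', add_assoc, add_assoc, hclosed]
  refine ⟨h, hx, hy, fun x y hxR => ?_⟩
  rcases lt_abs.1 hxR with hxR | hxR
  · have hconst : ∀ n : ℕ, h x (y + n) = h x y := by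
      intro n
      induction n with
      | zero => simp
      | succ n ih =>
        rw [Nat.cast_succ, ← add_assoc, hy, ih, hV0 x _ (Or.inl (by rw [le_abs]; omega)), add_zero]
    rw [← hconst (R + |y|).toNat]
    simp only [hh]
    refine Finset.sum_eq_zero fun u _ => hH0 _ _ (Or.inr ?_)
    rw [le_abs]
    left
    have := neg_abs_le y
    have := abs_nonneg y
    omega
  · exact hleft _ _ (by omega)

open Classical in
/-- The indicator of the edges joining `C` and `V`. -/
def boundaryCochain (C V : Set (ℤ × ℤ)) (a b : ℤ × ℤ) : ZMod 2 :=
  if a ∈ C ∧ b ∈ V ∨ b ∈ C ∧ a ∈ V then 1 else 0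

lemma boundaryCochain_closed_on_square {C V : Set (ℤ × ℤ)} {x y : ℤ} (hVC : ∀ a ∈ V, a ∉ C)
    (h : ∀ a ∈ ({(x, y), (x + 1, y), (x, y + 1), (x + 1, y + 1)} : Set (ℤ × ℤ)),
      ∀ b ∈ ({(x, y), (x + 1, y), (x, y + 1), (x + 1, y + 1)} : Set (ℤ × ℤ)),
      ∀ d ∈ ({(x, y), (x + 1, y), (x, y + 1), (x + 1, y + 1)} : Set (ℤ × ℤ)),
      LatticeAdj a b → a ∈ C → d ∈ V → b ∉ C → b ∈ V) :
    boundaryCochain C V (x, y) (x + 1, y) + boundaryCochain C V (x + 1, y) (x + 1, y + 1)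
      = boundaryCochain C V (x, y) (x, y + 1)
        + boundaryCochain C V (x, y + 1) (x + 1, y + 1) := by
  by_cases hd : ∃ d ∈ ({(x, y), (x + 1, y), (x, y + 1), (x + 1, y + 1)} : Set (ℤ × ℤ)), d ∈ V
  · obtain ⟨d, hd, hdV⟩ := hd
    have key := fun a b ha hb hab haC hbC => h a ha b hb d hd hab haC hdV hbC
    have k1 := key (x, y) (x + 1, y) (by simp) (by simp) (by simp [LatticeAdj])
    have k2 := key (x + 1, y) (x, y) (by simp) (by simp) (by simp [LatticeAdj])
    have k3 := key (x, y) (x, y + 1) (by simp) (by simp) (by simp [LatticeAdj])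
    have k4 := key (x, y + 1) (x, y) (by simp) (by simp) (by simp [LatticeAdj])
    have k5 := key (x + 1, y) (x + 1, y + 1) (by simp) (by simp) (by simp [LatticeAdj])
    have k6 := key (x + 1, y + 1) (x + 1, y) (by simp) (by simp) (by simp [LatticeAdj])
    have k7 := key (x, y + 1) (x + 1, y + 1) (by simp) (by simp) (by simp [LatticeAdj])
    have k8 := key (x + 1, y + 1) (x, y + 1) (by simp) (by simp) (by simp [LatticeAdj])
    have p1 := hVC (x, y)
    have p2 := hVC (x + 1, y)
    have p3 := hVC (x, y + 1)
    have p4 := hVC (x + 1, y + 1)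
    have h11 : (1 : ZMod 2) + 1 = 0 := rfl
    clear key h
    by_cases (x, y) ∈ C <;> by_cases (x + 1, y) ∈ C <;> by_cases (x, y + 1) ∈ C <;>
      by_cases (x + 1, y + 1) ∈ C <;> simp_all [boundaryCochain]
  · have hd' : ∀ d ∈ ({(x, y), (x + 1, y), (x, y + 1), (x + 1, y + 1)} : Set (ℤ × ℤ)), d ∉ V :=
      fun d hd1 hd2 => hd ⟨d, hd1, hd2⟩
    simp only [Set.mem_insert_iff, Set.mem_singleton_iff, forall_eq_or_imp, forall_eq] at hd'
    simp [boundaryCochain, hd']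

/-- If a finite nearest-neighbour connected set `C` of sites contains the origin and all the sites
of its outer boundary lie in `W`, then the boundary joins the positive to the negative half-axis
through `W` with steps of sup-norm one. -/
lemma exists_star_reachable_of_finite (C W : Set (ℤ × ℤ)) (hC : C.Finite) (h0 : (0, 0) ∈ C)
    (hCW : Disjoint C W)
    (hbd : ∀ a ∈ C, ∀ b, LatticeAdj a b → b ∉ C → b ∈ W)
    (hconn : ∀ f : ℤ × ℤ → ZMod 2, (∀ a ∈ C, ∀ b ∈ C, LatticeAdj a b → f a = f b) →
      ∀ a ∈ C, f a = f (0, 0)) :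
    ∃ i j : ℕ, ((j : ℤ) + 1, (0 : ℤ)) ∈ W ∧
      (starGraph W).Reachable ((j : ℤ) + 1, 0) (-(i : ℤ) - 1, 0) := by
  classical
  obtain ⟨R, hR⟩ : ∃ R : ℤ, ∀ a ∈ C, |a.1| < R ∧ |a.2| < R := by
    obtain ⟨R1, h1⟩ := (hC.image fun a => |a.1|).bddAbove
    obtain ⟨R2, h2⟩ := (hC.image fun a => |a.2|).bddAbove
    refine ⟨max R1 R2 + 1, fun a ha => ?_⟩
    have := h1 (Set.mem_image_of_mem _ ha)
    have := h2 (Set.mem_image_of_mem _ ha)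
    omega
  have hex : ∀ e : ℤ, |e| = 1 → ∃ n : ℕ, (e * n, (0 : ℤ)) ∈ C ∧ ∀ m : ℕ, n < m →
      (e * m, (0 : ℤ)) ∉ C := by
    intro e he
    have hb : ∀ m : ℕ, (e * m, (0 : ℤ)) ∈ C → m ≤ R.toNat := fun m hm => by
      have := (hR _ hm).1
      simp only [abs_mul, he, one_mul, Nat.abs_cast] at this
      omega
    refine ⟨Nat.findGreatest (fun m : ℕ => (e * m, (0 : ℤ)) ∈ C) R.toNat,
      Nat.findGreatest_spec (P := fun m : ℕ => (e * m, (0 : ℤ)) ∈ C) (Nat.zero_le _) (by simpa),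
      fun m hm hmC => ?_⟩
    exact absurd hm (not_lt.2 (Nat.le_findGreatest (hb m hmC) hmC))
  obtain ⟨j, hjC, hj⟩ := hex 1 (by simp)
  obtain ⟨i, hiC, hi⟩ := hex (-1) (by simp)
  simp only [one_mul, neg_one_mul] at hjC hj hiC hi
  have hj1 : ((j : ℤ) + 1, (0 : ℤ)) ∉ C := by simpa using hj (j + 1) (by simp)
  have hi1 : (-(i : ℤ) - 1, (0 : ℤ)) ∉ C := by
    have := hi (i + 1) (by simp)
    rwa [Nat.cast_succ, neg_add'] at this
  have hjW : ((j : ℤ) + 1, (0 : ℤ)) ∈ W := hbd _ hjC _ (Or.inl rfl) hj1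
  have hiW : (-(i : ℤ) - 1, (0 : ℤ)) ∈ W := hbd _ hiC _ (Or.inr (Or.inl rfl)) hi1
  refine ⟨i, j, hjW, ?_⟩
  set V : Set (ℤ × ℤ) := {a | a ∈ W ∧ (starGraph W).Reachable ((j : ℤ) + 1, 0) a} with hVdef
  have hVC : ∀ a ∈ V, a ∉ C := fun a ha haC => Set.disjoint_left.1 hCW haC ha.1
  have hVstar : ∀ a ∈ V, ∀ b ∈ W, |a.1 - b.1| ≤ 1 → |a.2 - b.2| ≤ 1 → b ∈ V := by
    intro a ha b hb h1 h2
    by_cases hab : a = b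
    · exact hab ▸ ha
    · exact ⟨hb, ha.2.trans (SimpleGraph.Adj.reachable ⟨hab, ha.1, hb, h1, h2⟩)⟩
  set c := boundaryCochain C V with hc
  have hcC : ∀ a b, c a b ≠ 0 → a ∈ C ∨ b ∈ C := fun a b hab => by
    by_contra hcon
    rw [not_or] at hcon
    simp [hc, boundaryCochain, hcon.1, hcon.2] at hab
  obtain ⟨h, hhx, hhy, hh0⟩ := exists_primitive_of_closed (R + 1)
    (fun x y => c (x, y) (x + 1, y)) (fun x y => c (x, y) (x, y + 1)) (by
      intro x y hxy
      rcases hcC _ _ hxy with h | h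
      · have := hR _ h
        simp only at this
        omega
      · have := hR _ h
        simp only [abs_lt] at this ⊢
        omega) (by
      intro x y hxy
      rcases hcC _ _ hxy with h | h
      · have := hR _ h
        simp only at this
        omega
      · have := hR _ h
        simp only [abs_lt] at this ⊢
        omega) (by
      intro x y
      refine boundaryCochain_closed_on_square (C := C) (V := V) hVC ?_
      rintro a ha b hb d hd hab haC hdV hbC
      refine hVstar d hdV b (hbd a haC b hab hbC) ?_ ?_ <;>
        rcases hb with rfl | rfl | rfl | rfl <;> rcases hd with rfl | rfl | rfl | rfl <;> simp)
  have hstep : ∀ a ∈ C, ∀ b ∈ C, LatticeAdj a b → h a.1 a.2 = h b.1 b.2 := by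
    rintro ⟨x, y⟩ ha b hb hab
    have hc0 : ∀ a ∈ C, ∀ b ∈ C, c a b = 0 := fun a ha b hb => by
      have h1 : a ∉ V := fun h => hVC a h ha
      have h2 : b ∉ V := fun h => hVC b h hb
      simp [hc, boundaryCochain, h1, h2]
    rcases hab with rfl | rfl | rfl | rfl
    · simpa [hc0 _ ha _ hb] using (hhx x y).symm
    · simpa [hc0 _ hb _ ha] using hhx (x - 1) y
    · simpa [hc0 _ ha _ hb] using (hhy x y).symm
    · simpa [hc0 _ hb _ ha] using hhy x (y - 1)
  have hCconst := hconn (fun a => h a.1 a.2) hstep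
  have hright : ∀ n : ℕ, h (j + 1 + n) 0 = h (j + 1) 0 := by
    intro n
    induction n with
    | zero => simp
    | succ n ih =>
      rw [Nat.cast_succ, ← add_assoc, hhx, ih]
      have h1 := hj (j + 1 + n) (by omega)
      have h2 := hj (j + 1 + n + 1) (by omega)
      push_cast at h1 h2
      simp [hc, boundaryCochain, h1, h2]
  have hleft : ∀ n : ℕ, h (-i - 1 - n) 0 = h (-i - 1) 0 := by
    intro n
    induction n with
    | zero => simp
    | succ n ih =>
      rw [← ih, Nat.cast_succ, ← sub_sub]
      have := hhx (-i - 1 - n - 1) 0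
      have h1 := hi (i + 1 + n) (by omega)
      have h2 := hi (i + 1 + n + 1) (by omega)
      push_cast at h1 h2
      rw [show -((i : ℤ) + 1 + n) = -i - 1 - n by ring] at h1
      rw [show -((i : ℤ) + 1 + n + 1) = -i - 1 - n - 1 by ring] at h2
      simpa [hc, boundaryCochain, h1, h2] using this.symm
  have hj0 : h (j + 1) 0 = 0 := by
    rw [← hright (R.toNat + 2), hh0]
    rw [lt_abs]
    omega
  have hi0 : h (-i - 1) 0 = 0 := by
    rw [← hleft (R.toNat + 2), hh0]
    rw [lt_abs]
    omega
  by_contra hcon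
  have e1 := hhx j 0
  have e2 := hhx (-i - 1) 0
  have hjV : ((j : ℤ) + 1, (0 : ℤ)) ∈ V := ⟨hjW, SimpleGraph.Reachable.refl _⟩
  have hiV : (-(i : ℤ) - 1, (0 : ℤ)) ∉ V := fun h => hcon h.2
  have e3 : h j 0 = h (-i) 0 := (hCconst _ hjC).trans (hCconst _ hiC).symm
  simp [hc, boundaryCochain, hjC, hjV, hj0, hj1, hi1, hiV, hi0, sub_add_cancel] at e1 e2
  rw [e3, e2] at e1
  simp at e1

/-- The lists of `n + 1` consecutive sites of a walk of sup-norm steps at most one started at `v`. -/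
def starWalks : ℕ → ℤ × ℤ → Finset (List (ℤ × ℤ))
  | 0, v => {[v]}
  | n + 1, v => (Finset.Icc (v - 1) (v + 1)).biUnion fun u => (starWalks n u).image (v :: ·)

lemma card_starWalks_le (n : ℕ) (v : ℤ × ℤ) : (starWalks n v).card ≤ 9 ^ n := by
  induction n generalizing v with
  | zero => simp [starWalks]
  | succ n ih =>
    rw [starWalks, pow_succ, mul_comm]
    refine (Finset.card_biUnion_le_card_mul _ _ (9 ^ n) fun u _ =>
      Finset.card_image_le.trans (ih u)).trans (Nat.mul_le_mul_right _ ?_)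
    rw [Finset.card_Icc_prod]
    simp only [Int.card_Icc, Prod.fst_add, Prod.snd_add, Prod.fst_sub, Prod.snd_sub, Prod.fst_one,
      Prod.snd_one]
    ring_nf
    simp

lemma length_of_mem_starWalks {n : ℕ} {v : ℤ × ℤ} {L : List (ℤ × ℤ)} (hL : L ∈ starWalks n v) :
    L.length = n + 1 := by
  induction n generalizing v L with
  | zero => simp_all [starWalks]
  | succ n ih =>
    simp only [starWalks, Finset.mem_biUnion, Finset.mem_image] at hL
    obtain ⟨u, -, L', hL', rfl⟩ := hL
    simp [ih hL']

lemma support_mem_starWalks {W : Set (ℤ × ℤ)} {u v : ℤ × ℤ} (p : (starGraph W).Walk u v) :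
    p.support ∈ starWalks p.length u := by
  induction p with
  | nil => simp [starWalks]
  | @cons a b c hab p ih =>
    simp only [SimpleGraph.Walk.support_cons, SimpleGraph.Walk.length_cons, starWalks,
      Finset.mem_biUnion, Finset.mem_image]
    refine ⟨b, ?_, _, ih, rfl⟩
    obtain ⟨-, -, -, h1, h2⟩ := hab
    rw [abs_le] at h1 h2
    simp only [Finset.mem_Icc, Prod.le_def, Prod.fst_add, Prod.snd_add, Prod.fst_sub, Prod.snd_sub,
      Prod.fst_one, Prod.snd_one]
    omega

lemma support_subset_of_starGraph {W : Set (ℤ × ℤ)} {u v : ℤ × ℤ} (p : (starGraph W).Walk u v)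
    (hu : u ∈ W) : ∀ a ∈ p.support, a ∈ W := by
  induction p with
  | nil => simpa
  | cons h p ih =>
    rw [SimpleGraph.Walk.support_cons, List.forall_mem_cons]
    exact ⟨hu, ih h.2.2.1⟩

lemma fst_sub_fst_le_length {W : Set (ℤ × ℤ)} {u v : ℤ × ℤ} (p : (starGraph W).Walk u v) :
    u.1 - v.1 ≤ p.length := by
  induction p with
  | nil => simp
  | cons h p ih =>
    have := h.2.2.2.1
    rw [abs_le] at this
    rw [SimpleGraph.Walk.length_cons]
    push_cast
    linarith

/-- The sites reachable from the origin through nearest-neighbour steps within `G`. -/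
def originCluster (G : Set (ℤ × ℤ)) : Set (ℤ × ℤ) :=
  {v | Relation.ReflTransGen (fun a b => a ∈ G ∧ b ∈ G ∧ LatticeAdj a b) (0, 0) v}

lemma originCluster_subset {G : Set (ℤ × ℤ)} (h0 : (0, 0) ∈ G) : originCluster G ⊆ G := by
  rintro v hv
  rcases Relation.ReflTransGen.cases_tail hv with rfl | ⟨_, _, h⟩
  · exact h0
  · exact h.2.1

/-- Peierls' criterion: if the origin lies in `G` and no long self-avoiding walk in `Gᶜ` starts
on the positive half-axis, then the cluster of the origin is infinite. -/
lemma originCluster_infinite {G : Set (ℤ × ℤ)} (h0 : (0, 0) ∈ G)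
    (h : ∀ j : ℕ, ¬ ∃ L ∈ starWalks j ((j : ℤ) + 1, 0), L.Nodup ∧ ∀ a ∈ L, a ∈ Gᶜ) :
    (originCluster G).Infinite := by
  intro hfin
  have hsub := originCluster_subset h0
  obtain ⟨i, j, hjW, hreach⟩ := exists_star_reachable_of_finite (originCluster G) Gᶜ hfin
    Relation.ReflTransGen.refl (Set.disjoint_compl_right_iff_subset.2 hsub)
    (fun a ha b hab hb hbG => hb (Relation.ReflTransGen.tail ha ⟨hsub ha, hbG, hab⟩))
    (fun f hf a ha => by
      induction ha with
      | refl => rfl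
      | @tail b c hb hbc ih =>
        rw [← ih, hf b hb c (Relation.ReflTransGen.tail hb hbc) hbc.2.2])
  obtain ⟨p, hp⟩ := hreach.exists_isPath
  have hlen := fst_sub_fst_le_length p
  simp only at hlen
  have htake : (p.take j).length = j := by
    rw [SimpleGraph.Walk.take_length]
    omega
  refine h j ⟨(p.take j).support, ?_, (hp.take j).support_nodup,
    support_subset_of_starGraph _ hjW⟩
  simpa only [htake] using support_mem_starWalks (p.take j)

/-- If bad sites obey an exponential bound, then with positive probability the cluster of the origin
in the set of good sites is infinite. -/
lemma measure_originCluster_infinite_pos {Ω : Type*} [MeasurableSpace Ω] (P : Measure Ω)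
    [IsProbabilityMeasure P] (bad : ℤ × ℤ → Set Ω)
    (hbad : ∀ K : Finset (ℤ × ℤ), P {ω | ∀ i ∈ K, ω ∈ bad i} ≤ 2 * (18 : ℝ≥0∞)⁻¹ ^ K.card) :
    0 < P {ω | (0, 0) ∈ {i | ω ∉ bad i} ∧ (originCluster {i | ω ∉ bad i}).Infinite} := by
  rw [pos_iff_ne_zero]
  intro hzero
  set E : ℕ → Set Ω := fun j =>
    {ω | ∃ L ∈ starWalks j ((j : ℤ) + 1, 0), L.Nodup ∧ ∀ a ∈ L, a ∈ {i | ω ∉ bad i}ᶜ} with hE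
  have hcover : (Set.univ : Set Ω) ⊆
      {ω | (0, 0) ∈ {i | ω ∉ bad i} ∧ (originCluster {i | ω ∉ bad i}).Infinite} ∪
        (bad (0, 0) ∪ ⋃ j, E j) := by
    intro ω _
    by_cases h0 : ω ∈ bad (0, 0)
    · exact Or.inr (Or.inl h0)
    by_cases hj : ∃ j, ω ∈ E j
    · exact Or.inr (Or.inr (Set.mem_iUnion.2 hj))
    · exact Or.inl ⟨h0, originCluster_infinite h0 (not_exists.1 hj)⟩
  have hEj : ∀ j, P (E j) ≤ 9⁻¹ * (2 : ℝ≥0∞)⁻¹ ^ j := by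
    intro j
    have hsub : E j ⊆ ⋃ L ∈ (starWalks j ((j : ℤ) + 1, 0)).filter List.Nodup,
        {ω | ∀ i ∈ L.toFinset, ω ∈ bad i} := by
      rintro ω ⟨L, hL, hnd, h⟩
      simp only [Set.mem_iUnion, Finset.mem_filter]
      exact ⟨L, ⟨hL, hnd⟩, fun i hi => not_not.1 (h i (List.mem_toFinset.1 hi))⟩
    calc P (E j) ≤ ∑ L ∈ (starWalks j ((j : ℤ) + 1, 0)).filter List.Nodup,
          P {ω | ∀ i ∈ L.toFinset, ω ∈ bad i} :=
          (measure_mono hsub).trans (measure_biUnion_finset_le _ _)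
      _ ≤ ∑ L ∈ (starWalks j ((j : ℤ) + 1, 0)).filter List.Nodup,
          2 * (18 : ℝ≥0∞)⁻¹ ^ (j + 1) := by
          refine Finset.sum_le_sum fun L hL => (hbad _).trans_eq ?_
          rw [Finset.mem_filter] at hL
          rw [List.toFinset_card_of_nodup hL.2, length_of_mem_starWalks hL.1]
      _ ≤ (9 ^ j : ℕ) * (2 * (18 : ℝ≥0∞)⁻¹ ^ (j + 1)) := by
          rw [Finset.sum_const, nsmul_eq_mul]
          gcongr
          exact (Finset.card_filter_le _ _).trans (card_starWalks_le _ _)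
      _ = 9⁻¹ * (2 : ℝ≥0∞)⁻¹ ^ j := by
          rw [show (18 : ℝ≥0∞) = 9 * 2 by norm_num,
            ENNReal.mul_inv (by norm_num) (by norm_num), mul_pow, pow_succ, pow_succ]
          have h9 : (9 : ℝ≥0∞) ^ j * 9⁻¹ ^ j = 1 := by
            rw [← mul_pow, ENNReal.mul_inv_cancel (by norm_num) (by norm_num), one_pow]
          have h2 : (2 : ℝ≥0∞) * 2⁻¹ = 1 := ENNReal.mul_inv_cancel (by norm_num) (by norm_num)
          calc ((9 ^ j : ℕ) : ℝ≥0∞) * (2 * (9⁻¹ ^ j * 9⁻¹ * (2⁻¹ ^ j * 2⁻¹)))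
              = (9 ^ j * 9⁻¹ ^ j) * (2 * 2⁻¹) * (9⁻¹ * 2⁻¹ ^ j) := by push_cast; ring
            _ = _ := by rw [h9, h2]; simp
  have h0 : P (bad (0, 0)) ≤ 9⁻¹ := by
    have := hbad {(0, 0)}
    simp only [Finset.mem_singleton, forall_eq, Set.ofPred_mem_eq, Finset.card_singleton,
      pow_one] at this
    refine this.trans_eq ?_
    rw [show (18 : ℝ≥0∞) = 2 * 9 by norm_num, ENNReal.mul_inv (by norm_num) (by norm_num),
      ← mul_assoc, ENNReal.mul_inv_cancel (by norm_num) (by norm_num), one_mul]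
  have : (1 : ℝ≥0∞) ≤ 9⁻¹ + 9⁻¹ * 2 := by
    calc (1 : ℝ≥0∞) = P Set.univ := measure_univ.symm
      _ ≤ 0 + (P (bad (0, 0)) + ∑' j, P (E j)) := by
          refine (measure_mono hcover).trans ((measure_union_le _ _).trans ?_)
          rw [hzero]
          gcongr
          exact (measure_union_le _ _).trans (by gcongr; exact measure_iUnion_le _)
      _ ≤ 9⁻¹ + ∑' j, 9⁻¹ * (2 : ℝ≥0∞)⁻¹ ^ j := by
          rw [zero_add]
          exact add_le_add h0 (ENNReal.tsum_le_tsum hEj)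
      _ = _ := by
          rw [ENNReal.tsum_mul_left, ENNReal.tsum_geometric, ENNReal.one_sub_inv_two, inv_inv]
  rw [show (9 : ℝ≥0∞)⁻¹ + 9⁻¹ * 2 = 3 * 9⁻¹ by ring, ← div_eq_mul_inv,
    ENNReal.le_div_iff_mul_le (by norm_num) (by norm_num)] at this
  norm_num at this

/-- If two kinds of bad events satisfy exponential bounds, so does their union. -/
lemma measure_forall_mem_union_le {Ω ι : Type*} [MeasurableSpace Ω] (P : Measure Ω)
    (A B : ι → Set Ω) {r : ℝ≥0∞} (hr : r ≤ 1)
    (hA : ∀ K : Finset ι, P {ω | ∀ i ∈ K, ω ∈ A i} ≤ (r ^ 2) ^ K.card)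
    (hB : ∀ K : Finset ι, P {ω | ∀ i ∈ K, ω ∈ B i} ≤ (r ^ 2) ^ K.card) (K : Finset ι) :
    P {ω | ∀ i ∈ K, ω ∈ A i ∪ B i} ≤ 2 * (2 * r) ^ K.card := by
  classical
  set F := K.powerset.filter fun S => K.card ≤ 2 * S.card with hF
  have hsub : {ω | ∀ i ∈ K, ω ∈ A i ∪ B i} ⊆
      ⋃ S ∈ F, ({ω | ∀ i ∈ S, ω ∈ A i} ∪ {ω | ∀ i ∈ S, ω ∈ B i}) := by
    intro ω hω
    simp only [Set.mem_iUnion, hF, Finset.mem_filter, Finset.mem_powerset]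
    have hcard := Finset.card_filter_add_card_filter_not (s := K) (fun i => ω ∈ A i)
    rcases le_total (K.filter fun i => ω ∉ A i).card (K.filter fun i => ω ∈ A i).card with h | h
    · exact ⟨K.filter fun i => ω ∈ A i, ⟨Finset.filter_subset _ _, by omega⟩,
        Or.inl fun i hi => (Finset.mem_filter.1 hi).2⟩
    · refine ⟨K.filter fun i => ω ∉ A i, ⟨Finset.filter_subset _ _, by omega⟩, Or.inr fun i hi => ?_⟩
      obtain ⟨hiK, hiA⟩ := Finset.mem_filter.1 hi
      exact (hω i hiK).resolve_left hiA
  calc P {ω | ∀ i ∈ K, ω ∈ A i ∪ B i}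
      ≤ ∑ S ∈ F, P ({ω | ∀ i ∈ S, ω ∈ A i} ∪ {ω | ∀ i ∈ S, ω ∈ B i}) :=
        (measure_mono hsub).trans (measure_biUnion_finset_le _ _)
    _ ≤ ∑ S ∈ F, 2 * r ^ K.card := by
        refine Finset.sum_le_sum fun S hS => (measure_union_le _ _).trans ?_
        rw [two_mul]
        have hle : (r ^ 2) ^ S.card ≤ r ^ K.card := by
          rw [← pow_mul]
          exact pow_le_pow_right_of_le_one' hr (Finset.mem_filter.1 hS).2
        exact add_le_add ((hA S).trans hle) ((hB S).trans hle)
    _ ≤ (2 ^ K.card : ℕ) * (2 * r ^ K.card) := by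
        rw [Finset.sum_const, nsmul_eq_mul]
        gcongr
        exact (Finset.card_filter_le _ _).trans (Finset.card_powerset _).le
    _ = _ := by push_cast; rw [mul_pow]; ring

/-- The index of the half-open square of side `s` that contains a point. -/
def cellIndex (s : ℝ) (x : E2) : ℤ × ℤ := (⌊x 0 / s⌋, ⌊x 1 / s⌋)

/-- The half-open squares of side `s` partitioning the plane. -/
def cell (s : ℝ) (i : ℤ × ℤ) : Set E2 := cellIndex s ⁻¹' {i}

lemma measurable_cellIndex (s : ℝ) : Measurable (cellIndex s) := by
  unfold cellIndex
  fun_prop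

lemma measurableSet_cell (s : ℝ) (i : ℤ × ℤ) : MeasurableSet (cell s i) :=
  measurable_cellIndex s (measurableSet_singleton i)

lemma disjoint_cell (s : ℝ) {i j : ℤ × ℤ} (h : i ≠ j) : Disjoint (cell s i) (cell s j) :=
  Disjoint.preimage _ (Set.disjoint_singleton.2 h)

lemma abs_sub_le_dist (x y : E2) (k : Fin 2) : |x k - y k| ≤ dist x y := by
  rw [dist_eq_norm, ← Real.norm_eq_abs]
  exact PiLp.norm_apply_le (x - y) k

lemma dist_le_abs_add_abs (x y : E2) : dist x y ≤ |x 0 - y 0| + |x 1 - y 1| := by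
  rw [EuclideanSpace.dist_eq, Fin.sum_univ_two]
  refine Real.sqrt_le_iff.2 ⟨by positivity, ?_⟩
  rw [Real.dist_eq, Real.dist_eq]
  nlinarith [abs_nonneg (x 0 - y 0), abs_nonneg (x 1 - y 1)]

lemma abs_sub_le_of_floor {s : ℝ} (hs : 0 < s) (a b : ℝ) :
    |a - b| ≤ s * (|(⌊a / s⌋ - ⌊b / s⌋ : ℤ)| + 1 : ℤ) := by
  have ha := Int.floor_le (a / s)
  have ha' := Int.lt_floor_add_one (a / s)
  have hb := Int.floor_le (b / s)
  have hb' := Int.lt_floor_add_one (b / s)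
  have key : |a / s - b / s| ≤ |(⌊a / s⌋ : ℝ) - ⌊b / s⌋| + 1 := by
    have := le_abs_self ((⌊a / s⌋ : ℝ) - ⌊b / s⌋)
    have := neg_abs_le ((⌊a / s⌋ : ℝ) - ⌊b / s⌋)
    rw [abs_le]
    constructor <;> linarith
  rw [← sub_div, abs_div, abs_of_pos hs, div_le_iff₀ hs] at key
  push_cast
  linarith

lemma mul_abs_floor_sub_le {s : ℝ} (hs : 0 < s) (a b : ℝ) :
    s * ((|⌊a / s⌋ - ⌊b / s⌋| : ℤ) - 1 : ℝ) ≤ |a - b| := by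
  have ha := Int.floor_le (a / s)
  have ha' := Int.lt_floor_add_one (a / s)
  have hb := Int.floor_le (b / s)
  have hb' := Int.lt_floor_add_one (b / s)
  have key : |(⌊a / s⌋ : ℝ) - ⌊b / s⌋| - 1 ≤ |a / s - b / s| := by
    have := le_abs_self (a / s - b / s)
    have := neg_abs_le (a / s - b / s)
    rw [sub_le_iff_le_add, abs_le]
    constructor <;> linarith
  rw [← sub_div, abs_div, abs_of_pos hs, le_div_iff₀ hs] at key
  push_cast
  linarith

lemma dist_le_of_cellIndex {s : ℝ} (hs : 0 < s) {x y : E2} (k : ℤ)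
    (h1 : |(cellIndex s x).1 - (cellIndex s y).1| ≤ k)
    (h2 : |(cellIndex s x).2 - (cellIndex s y).2| ≤ k) : dist x y ≤ 2 * s * (k + 1) := by
  have e1 := abs_sub_le_of_floor hs (x 0) (y 0)
  have e2 := abs_sub_le_of_floor hs (x 1) (y 1)
  have e3 : s * ((|(⌊x 0 / s⌋ - ⌊y 0 / s⌋ : ℤ)| + 1 : ℤ) : ℝ) ≤ s * (k + 1) := by
    gcongr
    exact_mod_cast add_le_add_left h1 1
  have e4 : s * ((|(⌊x 1 / s⌋ - ⌊y 1 / s⌋ : ℤ)| + 1 : ℤ) : ℝ) ≤ s * (k + 1) := by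
    gcongr
    exact_mod_cast add_le_add_left h2 1
  linarith [dist_le_abs_add_abs x y]

lemma dist_le_of_mem_cell {s : ℝ} (hs : 0 < s) {i : ℤ × ℤ} {x y : E2} (hx : x ∈ cell s i)
    (hy : y ∈ cell s i) : dist x y ≤ 2 * s := by
  have hx : cellIndex s x = i := hx
  have hy : cellIndex s y = i := hy
  simpa using dist_le_of_cellIndex hs (x := x) (y := y) 0 (by simp [hx, hy]) (by simp [hx, hy])

lemma isBounded_cell {s : ℝ} (hs : 0 < s) (i : ℤ × ℤ) : Bornology.IsBounded (cell s i) :=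
  Metric.isBounded_iff.2 ⟨_, fun _ hx _ hy => dist_le_of_mem_cell hs hx hy⟩

lemma volume_cell {s : ℝ} (hs : 0 < s) (i : ℤ × ℤ) :
    volume (cell s i) = ENNReal.ofReal (s ^ 2) := by
  have hpre : cell s i = (fun x : E2 => (WithLp.ofLp x : Fin 2 → ℝ)) ⁻¹'
      (Set.univ.pi fun k => Set.Ico (s * ![(i.1 : ℝ), i.2] k) (s * (![(i.1 : ℝ), i.2] k + 1))) := by
    ext x
    have key : ∀ (a : ℝ) (n : ℤ), ⌊a / s⌋ = n ↔ s * n ≤ a ∧ a < s * (n + 1) := fun a n => by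
      rw [Int.floor_eq_iff, le_div_iff₀ hs, div_lt_iff₀ hs, mul_comm s, mul_comm s]
    simp only [cell, cellIndex, Set.mem_preimage, Set.mem_singleton_iff, Prod.ext_iff, key,
      Set.mem_pi, Set.mem_univ, forall_const, Fin.forall_fin_two, Set.mem_Ico]
    rfl
  rw [hpre, (PiLp.volume_preserving_ofLp (Fin 2)).measure_preimage
    (MeasurableSet.univ_pi fun _ => measurableSet_Ico).nullMeasurableSet, Real.volume_pi_Ico]
  simp only [mul_add, mul_one, add_sub_cancel_left, Fin.prod_univ_two]
  rw [← ENNReal.ofReal_mul hs.le, sq]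

lemma exists_finset_cellIndex {s : ℝ} (hs : 0 < s) {B : Set E2} (hB : Bornology.IsBounded B) :
    ∃ T : Finset (ℤ × ℤ), ∀ x ∈ B, cellIndex s x ∈ T := by
  obtain ⟨R, hR⟩ := (Metric.isBounded_iff_subset_closedBall 0).1 hB
  refine ⟨Finset.Icc (⌊-R / s⌋, ⌊-R / s⌋) (⌊R / s⌋, ⌊R / s⌋), fun x hx => ?_⟩
  have hk : ∀ k, -R ≤ x k ∧ x k ≤ R := fun k => by
    have h1 := abs_sub_le_dist x 0 k
    have h2 := hR hx
    rw [mem_closedBall] at h2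
    simpa using abs_le.1 (h1.trans h2)
  simp only [Finset.mem_Icc, Prod.le_def, cellIndex]
  refine ⟨⟨?_, ?_⟩, ⟨?_, ?_⟩⟩ <;> refine Int.floor_le_floor ?_ <;> gcongr
  exacts [(hk 0).1, (hk 1).1, (hk 0).2, (hk 1).2]

lemma sum_measure_inter_cell (ν : Measure E2) {s : ℝ} {B : Set E2} {T : Finset (ℤ × ℤ)}
    (hT : ∀ x ∈ B, cellIndex s x ∈ T) : ∑ c ∈ T, ν (B ∩ cell s c) = ν B := by
  have := sum_measure_preimage_singleton (μ := ν.restrict B) T (f := cellIndex s)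
    fun c _ => measurableSet_cell s c
  have hBT : B ∩ cellIndex s ⁻¹' (T : Set (ℤ × ℤ)) = B := Set.inter_eq_left.2 hT
  rw [Measure.restrict_apply (measurable_cellIndex s (Finset.measurableSet _)), Set.inter_comm,
    hBT] at this
  rw [← this]
  refine Finset.sum_congr rfl fun c _ => ?_
  change _ = ν.restrict B (cell s c)
  rw [Measure.restrict_apply (measurableSet_cell s c), Set.inter_comm]

lemma sum_measure_inter_cell_le (ν : Measure E2) (s : ℝ) {B : Set E2} (hB : MeasurableSet B)
    (T : Finset (ℤ × ℤ)) : ∑ c ∈ T, ν (B ∩ cell s c) ≤ ν B := by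
  rw [← measure_biUnion_finset (fun c _ d _ hcd => ((disjoint_cell s hcd).mono
    Set.inter_subset_right Set.inter_subset_right)) fun c _ => hB.inter (measurableSet_cell s c)]
  exact measure_mono (Set.iUnion₂_subset fun _ _ => Set.inter_subset_left)

lemma volume_biUnion_cell {s : ℝ} (hs : 0 < s) (K : Finset (ℤ × ℤ)) :
    volume (⋃ i ∈ K, cell s i) = K.card * ENNReal.ofReal (s ^ 2) := by
  rw [measure_biUnion_finset (fun c _ d _ hcd => disjoint_cell s hcd)
    fun c _ => measurableSet_cell s c]
  simp [volume_cell hs]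

/-- A measure on the plane assigning integer mass to bounded Borel sets. -/
def IsCounting (ν : Measure E2) : Prop :=
  ∀ B : Set E2, MeasurableSet B → Bornology.IsBounded B → ∃ n : ℕ, ν B = n

lemma IsCounting.exists_ball_eq {ν : Measure E2} (hν : IsCounting ν) (x : E2) :
    ∃ r > 0, ν (ball x r) = ν {x} := by
  have hfin : ν (ball x 1) ≠ ∞ := by
    obtain ⟨n, hn⟩ := hν (ball x 1) measurableSet_ball isBounded_ball
    exact hn ▸ ENNReal.natCast_ne_top n
  have hlim := tendsto_measure_iInter_atTop (μ := ν) (s := fun n : ℕ => ball x (1 / (n + 1)))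
    (fun n => measurableSet_ball.nullMeasurableSet)
    (fun m n hmn => ball_subset_ball (Nat.one_div_le_one_div hmn)) ⟨0, by simpa using hfin⟩
  have hinter : ⋂ n : ℕ, ball x (1 / ((n : ℝ) + 1)) = {x} := by
    ext y
    simp only [Set.mem_iInter, mem_ball, Set.mem_singleton_iff]
    refine ⟨fun h => ?_, fun h n => ?_⟩
    · by_contra hne
      obtain ⟨n, hn⟩ := exists_nat_one_div_lt (dist_pos.2 hne)
      exact lt_asymm (h n) hn
    · rw [h, dist_self]
      positivity
  rw [hinter] at hlim
  obtain ⟨k, hk⟩ := hν {x} (measurableSet_singleton x) Bornology.isBounded_singleton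
  have hlt : ν {x} < (k + 1 : ℕ) := by
    rw [hk]
    exact_mod_cast Nat.lt_succ_self k
  obtain ⟨n, hn⟩ := (hlim.eventually_lt_const hlt).exists
  refine ⟨1 / (n + 1), by positivity, le_antisymm ?_ (measure_mono ?_)⟩
  · obtain ⟨m, hm⟩ := hν (ball x (1 / ((n : ℝ) + 1))) measurableSet_ball isBounded_ball
    simp only [Function.comp_apply, hm] at hn
    rw [hm, hk]
    exact_mod_cast Nat.lt_succ_iff.1 (by exact_mod_cast hn)
  · exact Set.singleton_subset_iff.2 (mem_ball_self (by positivity))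

lemma IsCounting.exists_atom {ν : Measure E2} (hν : IsCounting ν) {B : Set E2} (hB : ν B ≠ 0) :
    ∃ x ∈ B, x ∈ atomsOf ν := by
  by_contra! hcon
  refine hB (measure_null_of_locally_null B fun x hx => ?_)
  obtain ⟨r, hr, h⟩ := hν.exists_ball_eq x
  exact ⟨_, mem_nhdsWithin_of_mem_nhds (ball_mem_nhds x hr), h.trans (not_not.1 (hcon x hx))⟩

lemma IsCounting.exists_forall_le_one {ν : Measure E2} (hν : IsCounting ν)
    (hsimple : ∀ x, ν {x} ≤ 1) {B : Set E2} (hB : Bornology.IsBounded B) :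
    ∃ δ > 0, ∀ A ⊆ B, (∀ x ∈ A, ∀ y ∈ A, dist x y < δ) → ν A ≤ 1 := by
  choose r hr h using hν.exists_ball_eq
  obtain ⟨δ, hδ, hleb⟩ := lebesgue_number_lemma_of_metric hB.isCompact_closure
    (c := fun x => ball x (r x)) (fun x => isOpen_ball)
    (fun x _ => Set.mem_iUnion.2 ⟨x, mem_ball_self (hr x)⟩)
  refine ⟨δ, hδ, fun A hAB hA => ?_⟩
  rcases A.eq_empty_or_nonempty with rfl | ⟨x, hx⟩
  · simp
  obtain ⟨z, hz⟩ := hleb x (subset_closure (hAB hx))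
  calc ν A ≤ ν (ball z (r z)) := measure_mono fun y hy => hz (hA y hy x hx)
    _ ≤ 1 := (h z).trans_le (hsimple z)

lemma IsCounting.eventually_prod_one_add_eq {ν : Measure E2} (hν : IsCounting ν)
    (hsimple : ∀ x, ν {x} ≤ 1) {B : Set E2} (hBm : MeasurableSet B) (hB : Bornology.IsBounded B)
    {b : ℝ} (hb : 0 ≤ b) (T : ℕ → Finset (ℤ × ℤ))
    (hT : ∀ n : ℕ, ∀ x ∈ B, cellIndex (1 / (n + 1)) x ∈ T n) :
    ∀ᶠ n : ℕ in Filter.atTop,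
      ∏ c ∈ T n, (1 + ENNReal.ofReal (Real.exp b - 1) * ν (B ∩ cell (1 / (n + 1)) c)) =
        ENNReal.ofReal (Real.exp (b * (ν B).toReal)) := by
  obtain ⟨δ, hδ, hle⟩ := hν.exists_forall_le_one hsimple hB
  have hlim : Filter.Tendsto (fun n : ℕ => 2 * (1 / ((n : ℝ) + 1))) Filter.atTop (nhds (2 * 0)) :=
    tendsto_one_div_add_atTop_nhds_zero_nat.const_mul 2
  filter_upwards [hlim.eventually_lt_const (by simpa using hδ)] with n hn
  have hfactor : ∀ c, 1 + ENNReal.ofReal (Real.exp b - 1) * ν (B ∩ cell (1 / (n + 1)) c) =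
      ENNReal.ofReal (Real.exp (b * (ν (B ∩ cell (1 / (n + 1)) c)).toReal)) := by
    intro c
    obtain ⟨m, hm⟩ := hν (B ∩ cell (1 / (n + 1)) c)
      (hBm.inter (measurableSet_cell _ _)) (hB.subset Set.inter_subset_left)
    have h1 := hle (B ∩ cell (1 / (n + 1)) c) Set.inter_subset_left fun x hx y hy =>
      (dist_le_of_mem_cell (by positivity) hx.2 hy.2).trans_lt hn
    rw [hm] at h1 ⊢
    have hm1 : m ≤ 1 := by exact_mod_cast h1
    interval_cases m
    · simp
    · rw [← ENNReal.ofReal_one, Nat.cast_one, mul_one, ← ENNReal.ofReal_add zero_le_one]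
      · simp
      · linarith [Real.add_one_le_exp b]
  have hfin : ∀ c ∈ T n, ν (B ∩ cell (1 / ((n : ℝ) + 1)) c) ≠ ∞ := by
    intro c _
    obtain ⟨m, hm⟩ := hν (B ∩ cell (1 / (n + 1)) c)
      (hBm.inter (measurableSet_cell _ _)) (hB.subset Set.inter_subset_left)
    exact hm ▸ ENNReal.natCast_ne_top m
  rw [Finset.prod_congr rfl fun c _ => hfactor c,
    ← ENNReal.ofReal_prod_of_nonneg fun c _ => (Real.exp_pos _).le, ← Real.exp_sum,
    ← Finset.mul_sum, ← ENNReal.toReal_sum hfin, sum_measure_inter_cell ν (hT n)]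

section Laplace

variable {Ω ι : Type*} [MeasurableSpace Ω] {P : Measure Ω} {X : Ω → Measure E2} {κ : ℝ}

lemma lintegral_prod_one_add_le [IsProbabilityMeasure P] (hX : Measurable X)
    (hmean : ∀ B : Set E2, MeasurableSet B → ∫⁻ ω, X ω B ∂P = ENNReal.ofReal κ * volume B)
    (hsub : ∀ (k : ℕ) (B : Fin k → Set E2),
      (∀ i, MeasurableSet (B i) ∧ Bornology.IsBounded (B i)) →
      Pairwise (Function.onFun Disjoint B) →
      ∫⁻ ω, ∏ i, X ω (B i) ∂P ≤ ∏ i, ∫⁻ ω, X ω (B i) ∂P)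
    (F : Finset ι) (B : ι → Set E2) (hB : ∀ i, MeasurableSet (B i) ∧ Bornology.IsBounded (B i))
    (hdisj : Pairwise (Function.onFun Disjoint B)) (e : ι → ℝ≥0∞) :
    ∫⁻ ω, ∏ i ∈ F, (1 + e i * X ω (B i)) ∂P ≤
      ∏ i ∈ F, (1 + e i * (ENNReal.ofReal κ * volume (B i))) := by
  classical
  have hmeas : ∀ i, Measurable fun ω => X ω (B i) := fun i =>
    (Measure.measurable_coe (hB i).1).comp hX
  have hS : ∀ S : Finset ι, ∫⁻ ω, ∏ i ∈ S, X ω (B i) ∂P ≤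
      ∏ i ∈ S, (ENNReal.ofReal κ * volume (B i)) := by
    intro S
    have key : ∀ f : ι → ℝ≥0∞, ∏ i ∈ S, f i = ∏ k : Fin S.card, f (S.equivFin.symm k) := fun f => by
      rw [← Finset.prod_coe_sort]
      exact (Equiv.prod_comp S.equivFin.symm (fun i : S => f i)).symm
    simp_rw [key, ← hmean _ (hB _).1]
    exact hsub S.card (fun k => B (S.equivFin.symm k)) (fun k => hB _)
      fun k l hkl => hdisj fun h => hkl (S.equivFin.symm.injective (Subtype.ext h))
  simp_rw [Finset.prod_one_add]
  rw [lintegral_finsetSum _ fun S _ =>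
    Finset.measurable_fun_prod S fun i _ => (hmeas i).const_mul _]
  refine Finset.sum_le_sum fun S _ => ?_
  calc ∫⁻ ω, ∏ i ∈ S, e i * X ω (B i) ∂P
      = (∏ i ∈ S, e i) * ∫⁻ ω, ∏ i ∈ S, X ω (B i) ∂P := by
        rw [← lintegral_const_mul _ (Finset.measurable_fun_prod S fun i _ => hmeas i)]
        simp_rw [Finset.prod_mul_distrib]
    _ ≤ (∏ i ∈ S, e i) * ∏ i ∈ S, (ENNReal.ofReal κ * volume (B i)) := by gcongr; exact hS S
    _ = _ := Finset.prod_mul_distrib.symm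

/-- Chernoff bound for weighted counts of a simple α-weakly sub-Poisson point process. -/
lemma measure_lt_sum_le [IsProbabilityMeasure P] (hX : Measurable X)
    (hcount : ∀ᵐ ω ∂P, IsCounting (X ω)) (hsimple : ∀ᵐ ω ∂P, ∀ x, X ω {x} ≤ 1) (hκ : 0 ≤ κ)
    (hmean : ∀ B : Set E2, MeasurableSet B → ∫⁻ ω, X ω B ∂P = ENNReal.ofReal κ * volume B)
    (hsub : ∀ (k : ℕ) (B : Fin k → Set E2),
      (∀ i, MeasurableSet (B i) ∧ Bornology.IsBounded (B i)) →
      Pairwise (Function.onFun Disjoint B) →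
      ∫⁻ ω, ∏ i, X ω (B i) ∂P ≤ ∏ i, ∫⁻ ω, X ω (B i) ∂P)
    (F : Finset ι) (B : ι → Set E2) (hB : ∀ i, MeasurableSet (B i) ∧ Bornology.IsBounded (B i))
    (hdisj : Pairwise (Function.onFun Disjoint B)) (b : ι → ℝ) (hb : ∀ i, 0 ≤ b i) (x : ℝ) :
    P {ω | ENNReal.ofReal x < ∑ i ∈ F, ENNReal.ofReal (b i) * X ω (B i)} ≤
      ENNReal.ofReal (Real.exp
        (-x + ∑ i ∈ F, (Real.exp (b i) - 1) * (κ * (volume (B i)).toReal))) := by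
  classical
  choose T' hT' using fun (n : ℕ) (i : ι) =>
    exists_finset_cellIndex (s := 1 / ((n : ℝ) + 1)) (by positivity) (hB i).2
  set T : ℕ → Finset (ℤ × ℤ) := fun n => F.biUnion (T' n) with hTdef
  have hT : ∀ i ∈ F, ∀ n : ℕ, ∀ y ∈ B i, cellIndex (1 / (n + 1)) y ∈ T n := fun i hi n y hy =>
    Finset.mem_biUnion.2 ⟨i, hi, hT' n i y hy⟩
  set e : ι → ℝ≥0∞ := fun i => ENNReal.ofReal (Real.exp (b i) - 1) with he
  have hexp : ∀ i, 0 ≤ Real.exp (b i) - 1 := fun i => by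
    linarith [Real.add_one_le_exp (b i), hb i]
  set f : ℕ → Ω → ℝ≥0∞ := fun n ω =>
    ∏ i ∈ F, ∏ c ∈ T n, (1 + e i * X ω (B i ∩ cell (1 / (n + 1)) c)) with hf
  have hcell : ∀ (n : ℕ) (i : ι) (c : ℤ × ℤ), MeasurableSet (B i ∩ cell (1 / ((n : ℝ) + 1)) c) :=
    fun n i c => (hB i).1.inter (measurableSet_cell _ _)
  have hfmeas : ∀ n, Measurable (f n) := fun n =>
    Finset.measurable_fun_prod _ fun i _ => Finset.measurable_fun_prod _ fun c _ =>
      (((Measure.measurable_coe (hcell n i c)).comp hX).const_mul _).const_add _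
  set I : ℝ := ∑ i ∈ F, (Real.exp (b i) - 1) * (κ * (volume (B i)).toReal) with hI
  have hbound : ∀ n, ∫⁻ ω, f n ω ∂P ≤ ENNReal.ofReal (Real.exp I) := by
    intro n
    have h1 := lintegral_prod_one_add_le hX hmean hsub (F ×ˢ T n)
      (fun p : ι × (ℤ × ℤ) => B p.1 ∩ cell (1 / ((n : ℝ) + 1)) p.2)
      (fun p => ⟨hcell n p.1 p.2, (hB p.1).2.subset Set.inter_subset_left⟩)
      (fun p q hpq => by
        by_cases h : p.1 = q.1
        · exact (disjoint_cell _ fun h' => hpq (Prod.ext h h')).mono Set.inter_subset_right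
            Set.inter_subset_right
        · exact (hdisj h).mono Set.inter_subset_left Set.inter_subset_left) (fun p => e p.1)
    simp only [Finset.prod_product] at h1
    refine h1.trans ?_
    rw [hI, Real.exp_sum, ENNReal.ofReal_prod_of_nonneg fun _ _ => (Real.exp_pos _).le]
    refine Finset.prod_le_prod' fun i _ => ?_
    have hfin : ∀ c ∈ T n, volume (B i ∩ cell (1 / ((n : ℝ) + 1)) c) ≠ ∞ := fun c _ =>
      (((hB i).2.subset Set.inter_subset_left).measure_lt_top).ne
    calc ∏ c ∈ T n, (1 + e i * (ENNReal.ofReal κ * volume (B i ∩ cell (1 / ((n : ℝ) + 1)) c)))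
        ≤ ∏ c ∈ T n, ENNReal.ofReal (Real.exp ((Real.exp (b i) - 1) *
            (κ * (volume (B i ∩ cell (1 / ((n : ℝ) + 1)) c)).toReal))) := by
          refine Finset.prod_le_prod' fun c hc => ?_
          rw [← ENNReal.ofReal_toReal (hfin c hc), ENNReal.toReal_ofReal ENNReal.toReal_nonneg,
            ← ENNReal.ofReal_mul hκ, he, ← ENNReal.ofReal_mul (hexp i), ← ENNReal.ofReal_one,
            ← ENNReal.ofReal_add zero_le_one (mul_nonneg (hexp i)
              (mul_nonneg hκ ENNReal.toReal_nonneg)), add_comm]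
          exact ENNReal.ofReal_le_ofReal (Real.add_one_le_exp _)
      _ = ENNReal.ofReal (Real.exp ((Real.exp (b i) - 1) *
            (κ * (∑ c ∈ T n, volume (B i ∩ cell (1 / ((n : ℝ) + 1)) c)).toReal))) := by
          rw [← ENNReal.ofReal_prod_of_nonneg fun _ _ => (Real.exp_pos _).le, ← Real.exp_sum,
            ← Finset.mul_sum, ← Finset.mul_sum, ENNReal.toReal_sum hfin]
      _ ≤ _ := by
          refine ENNReal.ofReal_le_ofReal (Real.exp_le_exp.2 ?_)
          refine mul_le_mul_of_nonneg_left (mul_le_mul_of_nonneg_left ?_ hκ) (hexp i)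
          exact ENNReal.toReal_mono (hB i).2.measure_lt_top.ne
            (sum_measure_inter_cell_le _ _ (hB i).1 _)
  set Y : Ω → ℝ≥0∞ := fun ω => Filter.liminf (fun n => f n ω) Filter.atTop with hY
  have hYint : ∫⁻ ω, Y ω ∂P ≤ ENNReal.ofReal (Real.exp I) :=
    (lintegral_liminf_le hfmeas).trans <| (Filter.liminf_le_liminf
      (Filter.Eventually.of_forall hbound)).trans_eq (Filter.liminf_const _)
  have hlarge : P {ω | ENNReal.ofReal x < ∑ i ∈ F, ENNReal.ofReal (b i) * X ω (B i)} ≤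
      P {ω | ENNReal.ofReal (Real.exp x) ≤ Y ω} := by
    refine measure_mono_ae ?_
    filter_upwards [hcount, hsimple] with ω hc hs hω
    have hω : ENNReal.ofReal x < ∑ i ∈ F, ENNReal.ofReal (b i) * X ω (B i) := hω
    have hev : ∀ᶠ n in Filter.atTop,
        f n ω = ENNReal.ofReal (Real.exp (∑ i ∈ F, b i * (X ω (B i)).toReal)) := by
      filter_upwards [(Filter.eventually_all_finset F).2 fun i hi =>
        hc.eventually_prod_one_add_eq hs (hB i).1 (hB i).2 (hb i) T (hT i hi)] with n hn
      rw [hf, Real.exp_sum, ENNReal.ofReal_prod_of_nonneg fun _ _ => (Real.exp_pos _).le]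
      exact Finset.prod_congr rfl hn
    have hYω : Y ω = ENNReal.ofReal (Real.exp (∑ i ∈ F, b i * (X ω (B i)).toReal)) := by
      rw [hY]
      exact (Filter.liminf_congr hev).trans (Filter.liminf_const _)
    change ENNReal.ofReal (Real.exp x) ≤ Y ω
    rw [hYω]
    refine ENNReal.ofReal_le_ofReal (Real.exp_le_exp.2 ?_)
    have hsum : ∑ i ∈ F, ENNReal.ofReal (b i) * X ω (B i) =
        ENNReal.ofReal (∑ i ∈ F, b i * (X ω (B i)).toReal) := by
      rw [ENNReal.ofReal_sum_of_nonneg fun i _ => mul_nonneg (hb i) ENNReal.toReal_nonneg]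
      refine Finset.sum_congr rfl fun i _ => ?_
      obtain ⟨m, hm⟩ := hc (B i) (hB i).1 (hB i).2
      rw [ENNReal.ofReal_mul (hb i), ENNReal.ofReal_toReal (hm ▸ ENNReal.natCast_ne_top m)]
    rw [hsum] at hω
    exact (ENNReal.lt_ofReal_iff_toReal_lt ENNReal.ofReal_ne_top).1 hω |>.le.trans' <| by
      rw [ENNReal.toReal_ofReal']
      exact le_max_left _ _
  have hmarkov := (mul_meas_ge_le_lintegral₀ (Measurable.liminf hfmeas).aemeasurable
    (ENNReal.ofReal (Real.exp x))).trans hYint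
  refine hlarge.trans ?_
  rw [Real.exp_add, Real.exp_neg, ENNReal.ofReal_mul (by positivity),
    ENNReal.ofReal_inv_of_pos (Real.exp_pos x)]
  rw [mul_comm (_⁻¹), ← div_eq_mul_inv, ENNReal.le_div_iff_mul_le
    (Or.inl (by simpa using Real.exp_pos x)) (Or.inl ENNReal.ofReal_ne_top), mul_comm]
  exact hmarkov

end Laplace

/-- An upper bound for `l (dist z y)` over the points `z`, `y` of squares of side `s` whose indices
differ by `d`. -/
def cellWeight (l : ℝ → ℝ) (s : ℝ) (d : ℤ × ℤ) : ℝ :=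
  l (s * ((max d.1.natAbs d.2.natAbs - 1 : ℕ) : ℝ))

lemma tsum_box_le (f : ℕ → ℝ≥0∞) :
    ∑' d : ℤ × ℤ, f (max d.1.natAbs d.2.natAbs) ≤ ∑' n : ℕ, (8 * n + 1) * f n := by
  classical
  calc ∑' d : ℤ × ℤ, f (max d.1.natAbs d.2.natAbs)
      = ∑' d : ℤ × ℤ, ∑' n : ℕ, if d ∈ Finset.box n then f n else 0 := by
        simp_rw [Int.mem_box, tsum_ite_eq']
    _ = ∑' n : ℕ, ∑' d : ℤ × ℤ, if d ∈ Finset.box n then f n else 0 := ENNReal.tsum_comm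
    _ ≤ _ := by
        refine ENNReal.tsum_le_tsum fun n => ?_
        rw [tsum_eq_sum (s := Finset.box n) fun d hd => if_neg hd,
          Finset.sum_congr rfl fun d hd => if_pos hd, Finset.sum_const, nsmul_eq_mul]
        gcongr
        rcases eq_or_ne n 0 with rfl | hn
        · simp
        · rw [Int.card_box hn]
          push_cast
          exact le_self_add

lemma summable_cellWeight {l : ℝ → ℝ} (hlanti : StrictAntiOn l (Set.Ici 0))
    (hlpos : ∀ x : ℝ, 0 ≤ x → 0 < l x)
    (hlint : ∫⁻ x in Set.Ioi (0 : ℝ), ENNReal.ofReal (x * l x) < ∞) {s : ℝ} (hs : 0 < s) :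
    Summable (cellWeight l s) := by
  have hpos : ∀ d, 0 ≤ cellWeight l s d := fun d => (hlpos _ (by positivity)).le
  suffices h : ∑' d, ENNReal.ofReal (cellWeight l s d) ≠ ∞ by
    simpa only [ENNReal.toReal_ofReal (hpos _)] using ENNReal.summable_toReal h
  set g : ℕ → ℝ≥0∞ := fun n => ENNReal.ofReal (l (s * ((n - 1 : ℕ) : ℝ))) with hg
  refine ne_top_of_le_ne_top ?_ (tsum_box_le g)
  rw [← ENNReal.summable.sum_add_tsum_nat_add' (k := 3)]
  refine ENNReal.add_ne_top.2 ⟨ENNReal.sum_ne_top.2 fun n _ => ENNReal.mul_ne_top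
    (by finiteness) ENNReal.ofReal_ne_top, ?_⟩
  set A : ℕ → Set ℝ := fun n => Set.Ioc (s * (n + 1 : ℕ)) (s * (n + 2 : ℕ)) with hA
  have hterm : ∀ n : ℕ, (8 * ((n + 3 : ℕ) : ℝ≥0∞) + 1) * g (n + 3) ≤
      ENNReal.ofReal (25 / s ^ 2) * ∫⁻ x in A n, ENNReal.ofReal (x * l x) := by
    intro n
    have hl : 0 ≤ l (s * (n + 2 : ℕ)) := (hlpos _ (by positivity)).le
    have h1 : ENNReal.ofReal (s * (n + 1 : ℕ) * l (s * (n + 2 : ℕ))) * ENNReal.ofReal s ≤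
        ∫⁻ x in A n, ENNReal.ofReal (x * l x) := by
      have hvol : volume (A n) = ENNReal.ofReal s := by
        rw [hA, Real.volume_Ioc]
        congr 1
        push_cast
        ring
      rw [← hvol, ← setLIntegral_const]
      refine setLIntegral_mono' measurableSet_Ioc fun x hx => ENNReal.ofReal_le_ofReal ?_
      have hx0 : 0 ≤ x := hx.1.le.trans' (by positivity)
      exact mul_le_mul hx.1.le (hlanti.antitoneOn hx0 (by simp; positivity) hx.2) hl hx0
    refine le_trans ?_ (mul_le_mul_right h1 _)
    have e1 : (8 * ((n + 3 : ℕ) : ℝ≥0∞) + 1) = ENNReal.ofReal (8 * ((n + 3 : ℕ) : ℝ) + 1) := by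
      rw [ENNReal.ofReal_add (by positivity) zero_le_one, ENNReal.ofReal_mul (by norm_num),
        ENNReal.ofReal_natCast]
      norm_num
    rw [e1, hg, ← ENNReal.ofReal_mul (by positivity), ← ENNReal.ofReal_mul (by positivity),
      ← ENNReal.ofReal_mul (by positivity)]
    refine ENNReal.ofReal_le_ofReal ?_
    have e2 : 25 / s ^ 2 * (s * ((n + 1 : ℕ) : ℝ) * l (s * (n + 2 : ℕ)) * s) =
        (25 * ((n + 1 : ℕ) : ℝ)) * l (s * (n + 2 : ℕ)) := by
      field_simp
    rw [e2]
    refine mul_le_mul_of_nonneg_right ?_ hl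
    push_cast
    have : (0 : ℝ) ≤ n := n.cast_nonneg
    linarith
  have hdisj : Pairwise (Function.onFun Disjoint A) := by
    have : Monotone fun n : ℕ => s * ((n + 1 : ℕ) : ℝ) := fun m n hmn => by
      dsimp only
      gcongr
    exact this.pairwise_disjoint_on_Ioc_succ
  refine ne_top_of_le_ne_top ?_ (ENNReal.tsum_le_tsum hterm)
  rw [ENNReal.tsum_mul_left, ← lintegral_iUnion (fun n => measurableSet_Ioc) hdisj]
  refine ENNReal.mul_ne_top ENNReal.ofReal_ne_top (ne_top_of_le_ne_top hlint.ne ?_)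
  exact lintegral_mono_set (Set.iUnion_subset fun n x hx =>
    lt_of_le_of_lt (by positivity) hx.1)

lemma lintegral_attenuation_le {l : ℝ → ℝ} (hlanti : StrictAntiOn l (Set.Ici 0)) {s : ℝ}
    (hs : 0 < s) (ν : Measure E2) {i : ℤ × ℤ} {y : E2} (hy : y ∈ cell s i) :
    ∫⁻ z, ENNReal.ofReal (l (dist z y)) ∂ν ≤
      ∑' j, ENNReal.ofReal (cellWeight l s (j - i)) * ν (cell s j) := by
  have hy : cellIndex s y = i := hy
  calc ∫⁻ z, ENNReal.ofReal (l (dist z y)) ∂ν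
      ≤ ∫⁻ z, ENNReal.ofReal (cellWeight l s (cellIndex s z - i)) ∂ν := by
        refine lintegral_mono fun z => ENNReal.ofReal_le_ofReal ?_
        refine hlanti.antitoneOn (Set.mem_Ici.2 (by positivity)) dist_nonneg ?_
        have h1 := (mul_abs_floor_sub_le hs (z 0) (y 0)).trans (abs_sub_le_dist z y 0)
        have h2 := (mul_abs_floor_sub_le hs (z 1) (y 1)).trans (abs_sub_le_dist z y 1)
        rw [← hy]
        simp only [cellIndex, Prod.fst_sub, Prod.snd_sub]
        rw [← Int.natCast_natAbs, Int.cast_natCast] at h1 h2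
        set p := (⌊z 0 / s⌋ - ⌊y 0 / s⌋).natAbs
        set q := (⌊z 1 / s⌋ - ⌊y 1 / s⌋).natAbs
        rcases Nat.eq_zero_or_pos (max p q) with h | h
        · simp [h]
        · rw [Nat.cast_sub h, Nat.cast_one]
          rcases le_total p q with hpq | hpq
          · rwa [max_eq_right hpq]
          · rwa [max_eq_left hpq]
    _ = ∫⁻ j, ENNReal.ofReal (cellWeight l s (j - i)) ∂(ν.map (cellIndex s)) :=
        (lintegral_map (f := fun j => ENNReal.ofReal (cellWeight l s (j - i)))
          (measurable_of_countable _) (measurable_cellIndex s)).symm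
    _ = _ := by
        rw [lintegral_countable']
        refine tsum_congr fun j => ?_
        rw [Measure.map_apply (measurable_cellIndex s) (measurableSet_singleton j)]
        rfl

/-- Exponential bound for the probability that the interference, up to discretization, is large in
each of finitely many squares. -/
lemma measure_forall_interference_gt_le {Ω : Type*} [MeasurableSpace Ω] {P : Measure Ω}
    [IsProbabilityMeasure P] {X : Ω → Measure E2} {κ : ℝ} (hX : Measurable X)
    (hcount : ∀ᵐ ω ∂P, IsCounting (X ω)) (hsimple : ∀ᵐ ω ∂P, ∀ x, X ω {x} ≤ 1) (hκ : 0 ≤ κ)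
    (hmean : ∀ B : Set E2, MeasurableSet B → ∫⁻ ω, X ω B ∂P = ENNReal.ofReal κ * volume B)
    (hsub : ∀ (k : ℕ) (B : Fin k → Set E2),
      (∀ i, MeasurableSet (B i) ∧ Bornology.IsBounded (B i)) →
      Pairwise (Function.onFun Disjoint B) →
      ∫⁻ ω, ∏ i, X ω (B i) ∂P ≤ ∏ i, ∫⁻ ω, X ω (B i) ∂P)
    {s : ℝ} (hs : 0 < s) {a : ℤ × ℤ → ℝ} (ha : ∀ d, 0 < a d) (hsum : Summable a) (M : ℝ)
    (K : Finset (ℤ × ℤ)) :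
    P {ω | ∀ i ∈ K, ω ∈ {ω | ENNReal.ofReal M <
        ∑' j, ENNReal.ofReal (a (j - i)) * X ω (cell s j)}} ≤
      ENNReal.ofReal (Real.exp (-(M / (∑' d, a d) - 2 * κ * s ^ 2))) ^ K.card := by
  rcases K.eq_empty_or_nonempty with rfl | hK
  · simp
  set A : ℝ := ∑' d, a d with hAdef
  have hA : 0 < A := hsum.tsum_pos (fun d => (ha d).le) 0 (ha 0)
  set b : ℤ × ℤ → ℝ := fun j => (∑ i ∈ K, a (j - i)) / A with hb
  have hb0 : ∀ j, 0 ≤ b j := fun j =>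
    div_nonneg (Finset.sum_nonneg fun i _ => (ha _).le) hA.le
  have hb1 : ∀ j, b j ≤ 1 := fun j => by
    rw [hb, div_le_one hA]
    have h := ((Equiv.subLeft j).summable_iff.2 hsum).sum_le_tsum K fun i _ => (ha _).le
    rw [(Equiv.subLeft j).tsum_eq a |>.symm.trans rfl] at hAdef
    simpa [hAdef] using h
  have hbsum : ∀ F : Finset (ℤ × ℤ), ∑ j ∈ F, b j ≤ K.card := fun F => by
    rw [hb, ← Finset.sum_div, div_le_iff₀ hA, Finset.sum_comm, ← nsmul_eq_mul]
    refine Finset.sum_le_card_nsmul _ _ _ fun i _ => ?_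
    have h := ((Equiv.subRight i).summable_iff.2 hsum).sum_le_tsum F fun j _ => (ha _).le
    refine h.trans_eq ?_
    exact (Equiv.subRight i).tsum_eq a
  set x : ℝ := K.card * (M / A) with hx
  set E : Finset (ℤ × ℤ) → Set Ω := fun F =>
    {ω | ENNReal.ofReal x < ∑ j ∈ F, ENNReal.ofReal (b j) * X ω (cell s j)} with hE
  have hcover : {ω | ∀ i ∈ K, ω ∈ {ω | ENNReal.ofReal M <
      ∑' j, ENNReal.ofReal (a (j - i)) * X ω (cell s j)}} ⊆ ⋃ F, E F := by
    intro ω hω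
    have h1 : ∑ i ∈ K, ENNReal.ofReal M <
        ∑ i ∈ K, ∑' j, ENNReal.ofReal (a (j - i)) * X ω (cell s j) :=
      ENNReal.sum_lt_sum_of_nonempty hK hω
    have h2 : ∑ i ∈ K, ∑' j, ENNReal.ofReal (a (j - i)) * X ω (cell s j) =
        ENNReal.ofReal A * ∑' j, ENNReal.ofReal (b j) * X ω (cell s j) := by
      rw [← ENNReal.tsum_mul_left, ← Summable.tsum_finsetSum fun _ _ => ENNReal.summable]
      refine tsum_congr fun j => ?_
      rw [← mul_assoc, ← ENNReal.ofReal_mul hA.le, hb, mul_div_cancel₀ _ hA.ne',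
        ENNReal.ofReal_sum_of_nonneg fun i _ => (ha _).le, Finset.sum_mul]
    have h3 : ∑ i ∈ K, ENNReal.ofReal M = ENNReal.ofReal A * ENNReal.ofReal x := by
      rw [Finset.sum_const, nsmul_eq_mul, ← ENNReal.ofReal_mul hA.le, ← ENNReal.ofReal_natCast,
        ← ENNReal.ofReal_mul (by positivity)]
      congr 1
      rw [hx]
      field_simp
    rw [h2, h3, ENNReal.mul_lt_mul_iff_right (by simpa using hA) ENNReal.ofReal_ne_top,
      ENNReal.tsum_eq_iSup_sum, lt_iSup_iff] at h1
    exact Set.mem_iUnion.2 h1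
  have hdir : Directed (· ⊆ ·) E := by
    have hmono : Monotone E := fun F G hFG ω hω => by
      change ENNReal.ofReal x < ∑ j ∈ F, ENNReal.ofReal (b j) * X ω (cell s j) at hω
      exact hω.trans_le (Finset.sum_le_sum_of_subset hFG)
    exact hmono.directed_le
  refine (measure_mono hcover).trans ?_
  rw [hdir.measure_iUnion, ← ENNReal.ofReal_pow (Real.exp_pos _).le, ← Real.exp_nat_mul]
  refine iSup_le fun F => (measure_lt_sum_le hX hcount hsimple hκ hmean hsub F (cell s)
    (fun i => ⟨measurableSet_cell s i, isBounded_cell hs i⟩) (fun i j h => disjoint_cell s h)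
    b hb0 x).trans ?_
  refine ENNReal.ofReal_le_ofReal (Real.exp_le_exp.2 ?_)
  have hF : ∑ j ∈ F, (Real.exp (b j) - 1) * (κ * (volume (cell s j)).toReal) ≤
      2 * κ * s ^ 2 * K.card := by
    calc ∑ j ∈ F, (Real.exp (b j) - 1) * (κ * (volume (cell s j)).toReal)
        ≤ ∑ j ∈ F, 2 * κ * s ^ 2 * b j := by
          refine Finset.sum_le_sum fun j _ => ?_
          rw [volume_cell hs, ENNReal.toReal_ofReal (by positivity)]
          have h := Real.abs_exp_sub_one_le (x := b j) (by rw [abs_of_nonneg (hb0 j)]; exact hb1 j)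
          rw [abs_of_nonneg (hb0 j)] at h
          have := mul_le_mul_of_nonneg_right ((le_abs_self _).trans h)
            (by positivity : 0 ≤ κ * s ^ 2)
          linarith
      _ ≤ _ := by
          rw [← Finset.mul_sum]
          exact mul_le_mul_of_nonneg_left (hbsum F) (by positivity)
  rw [hx]
  linarith

/-- Exponential bound for the probability that finitely many squares are empty. -/
lemma measure_forall_cell_eq_zero_le {Ω : Type*} [MeasurableSpace Ω] {P : Measure Ω}
    {X : Ω → Measure E2} {κ : ℝ} (hκ : 0 ≤ κ)
    (hmean : ∀ B : Set E2, MeasurableSet B → ∫⁻ ω, X ω B ∂P = ENNReal.ofReal κ * volume B)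
    (hvoid : ∀ B : Set E2, MeasurableSet B → Bornology.IsBounded B →
      P {ω | X ω B = 0} ≤ ENNReal.ofReal (Real.exp (-(∫⁻ ω, X ω B ∂P).toReal)))
    {s : ℝ} (hs : 0 < s) (K : Finset (ℤ × ℤ)) :
    P {ω | ∀ i ∈ K, ω ∈ {ω | X ω (cell s i) = 0}} ≤
      ENNReal.ofReal (Real.exp (-(κ * s ^ 2))) ^ K.card := by
  have hsub : {ω | ∀ i ∈ K, ω ∈ {ω | X ω (cell s i) = 0}} ⊆
      {ω | X ω (⋃ i ∈ K, cell s i) = 0} := fun ω hω =>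
    (measure_biUnion_null_iff K.countable_toSet).2 hω
  have hmeas : MeasurableSet (⋃ i ∈ K, cell s i) :=
    K.measurableSet_biUnion fun i _ => measurableSet_cell s i
  refine (measure_mono hsub).trans ((hvoid _ hmeas
    ((Bornology.isBounded_biUnion_finset K).2 fun i _ => isBounded_cell hs i)).trans_eq ?_)
  rw [hmean _ hmeas, volume_biUnion_cell hs, ← ENNReal.ofReal_pow (Real.exp_pos _).le,
    ← Real.exp_nat_mul, ENNReal.toReal_mul, ENNReal.toReal_mul, ENNReal.toReal_ofReal hκ,
    ENNReal.toReal_natCast, ENNReal.toReal_ofReal (by positivity)]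
  ring_nf

/-- A graph on `V` percolates if each square of an infinite cluster meets `V` and points of `V` in
equal or neighbouring squares of the cluster are adjacent. -/
lemma graphPercolates_of_originCluster_infinite {V : Set E2} {A : E2 → E2 → Prop} {s : ℝ}
    {G : Set (ℤ × ℤ)} (h0 : (0, 0) ∈ G) (hinf : (originCluster G).Infinite)
    (hocc : ∀ i ∈ G, ∃ x ∈ cell s i, x ∈ V)
    (hadj : ∀ x y, x ≠ y → cellIndex s x ∈ G → cellIndex s y ∈ G →
      |(cellIndex s x).1 - (cellIndex s y).1| ≤ 1 → |(cellIndex s x).2 - (cellIndex s y).2| ≤ 1 →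
      A x y) :
    GraphPercolates V A := by
  have hsub := originCluster_subset h0
  set S : Set E2 := {x | x ∈ V ∧ cellIndex s x ∈ originCluster G} with hS
  set R : E2 → E2 → Prop := fun a b => a ∈ S ∧ b ∈ S ∧ A a b with hR
  have hstep : ∀ x ∈ S, ∀ y ∈ S, |(cellIndex s x).1 - (cellIndex s y).1| ≤ 1 →
      |(cellIndex s x).2 - (cellIndex s y).2| ≤ 1 →
      Relation.ReflTransGen R x y ∧ Relation.ReflTransGen R y x := by
    intro x hx y hy h1 h2
    rcases eq_or_ne x y with rfl | hne
    · exact ⟨.refl, .refl⟩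
    · exact ⟨.single ⟨hx, hy, hadj x y hne (hsub hx.2) (hsub hy.2) h1 h2⟩,
        .single ⟨hy, hx, hadj y x hne.symm (hsub hy.2) (hsub hx.2)
          (by rwa [abs_sub_comm]) (by rwa [abs_sub_comm])⟩⟩
  obtain ⟨o, hoc, hoV⟩ := hocc _ h0
  have hoc : cellIndex s o = (0, 0) := hoc
  have hoS : o ∈ S := ⟨hoV, hoc ▸ Relation.ReflTransGen.refl⟩
  have hreach : ∀ v ∈ originCluster G, ∀ x ∈ S, cellIndex s x = v →
      Relation.ReflTransGen R o x ∧ Relation.ReflTransGen R x o := by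
    intro v hv
    induction hv with
    | refl =>
      intro x hx hxv
      exact hstep o hoS x hx (by simp [hoc, hxv]) (by simp [hoc, hxv])
    | @tail b c hb hbc ih =>
      intro x hx hxc
      obtain ⟨y, hyb, hyV⟩ := hocc b hbc.1
      have hyb : cellIndex s y = b := hyb
      have hyS : y ∈ S := ⟨hyV, hyb.symm ▸ hb⟩
      have h := ih y hyS hyb
      have hyx : |(cellIndex s y).1 - (cellIndex s x).1| ≤ 1 ∧
          |(cellIndex s y).2 - (cellIndex s x).2| ≤ 1 := by
        rw [hyb, hxc]
        rcases hbc.2.2 with rfl | rfl | rfl | rfl <;> simp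
      have h' := hstep y hyS x hx hyx.1 hyx.2
      exact ⟨h.1.trans h'.1, h'.2.trans h.2⟩
  refine ⟨S, fun x hx => hx.1, ?_, fun x hx y hy =>
    (hreach _ hx.2 x hx rfl).2.trans (hreach _ hy.2 y hy rfl).1⟩
  refine Set.Infinite.of_image (cellIndex s) (hinf.mono fun v hv => ?_)
  obtain ⟨x, hxv, hxV⟩ := hocc v (hsub hv)
  have hxv : cellIndex s x = v := hxv
  exact ⟨x, ⟨hxV, hxv.symm ▸ hv⟩, hxv⟩

/-- The SINR condition holds, for suitable power and interference parameter, between points at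
distance at most `r` if the interference at the receiver is at most `M`. -/
lemma sinrGT_of_lintegral_le {l : ℝ → ℝ} (hlanti : StrictAntiOn l (Set.Ici 0)) {Nz T r M : ℝ}
    (hNz : 0 < Nz) (hT : 0 < T) (hr : 0 ≤ r) (hlr : 0 < l r) (hM : 0 < M) {ν : Measure E2}
    {x y : E2} (hxy : dist x y ≤ r)
    (hI : ∫⁻ z, ENNReal.ofReal (l (dist z y)) ∂ν ≤ ENNReal.ofReal M) :
    sinrGT l (4 * T * Nz / l r) Nz T (l r / (4 * T * M)) ν x y := by
  have hγ : l r / (4 * T * M) * (4 * T * Nz / l r) * M = Nz := by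
    field_simp
  calc ENNReal.ofReal T * (ENNReal.ofReal Nz +
        ENNReal.ofReal (l r / (4 * T * M) * (4 * T * Nz / l r)) *
          ∫⁻ z in ({x, y}ᶜ : Set E2), ENNReal.ofReal (l (dist z y)) ∂ν)
      ≤ ENNReal.ofReal T * (ENNReal.ofReal Nz +
        ENNReal.ofReal (l r / (4 * T * M) * (4 * T * Nz / l r)) * ENNReal.ofReal M) := by
        gcongr
        exact (setLIntegral_le_lintegral _ _).trans hI
    _ = ENNReal.ofReal (T * (Nz + Nz)) := by
        rw [← ENNReal.ofReal_mul (by positivity), hγ, ← ENNReal.ofReal_add hNz.le hNz.le,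
          ← ENNReal.ofReal_mul hT.le]
    _ < ENNReal.ofReal (4 * T * Nz / l r * l r) := by
        rw [div_mul_cancel₀ _ hlr.ne']
        have := mul_pos hT hNz
        exact (ENNReal.ofReal_lt_ofReal_iff (by positivity)).2 (by linarith)
    _ ≤ _ := ENNReal.ofReal_le_ofReal (mul_le_mul_of_nonneg_left
        (hlanti.antitoneOn (Set.mem_Ici.2 dist_nonneg) (Set.mem_Ici.2 hr) hxy) (by positivity))

/-- for SINR parameters `N, T > 0`, an everywhere positive admissible
attenuation function `l`, a stationary ν-weakly sub-Poisson backbone process `Φ` and an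
α-weakly sub-Poisson interferer process `Φ_I` of intensity `μ > 0` (not necessarily
independent of `Φ`), there exist a power `P > 0` and `γ > 0` such that the SINR graph
`G(Φ, Φ_I, γ)` percolates with positive probability. -/
theorem sinr_percolation_nonpoisson_backbone
    (Nz T : ℝ) (hNz : 0 < Nz) (hT : 0 < T)
    (l : ℝ → ℝ)
    (hlcont : ContinuousOn l (Set.Ici 0))
    (hlanti : StrictAntiOn l (Set.Ici 0))
    (hlpos : ∀ x : ℝ, 0 ≤ x → 0 < l x)
    (hl1 : ∀ x : ℝ, l x ≤ 1)
    (hlint : ∫⁻ x in Set.Ioi (0 : ℝ), ENNReal.ofReal (x * l x) < ∞)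
    {Ω : Type*} [MeasurableSpace Ω] (P : Measure Ω) [IsProbabilityMeasure P]
    -- the backbone: a stationary, ν-weakly sub-Poisson point process of intensity `lam`
    (Φ : Ω → Measure E2) (hΦmeas : Measurable Φ)
    (hΦcount : ∀ᵐ ω ∂P, ∀ B : Set E2,
      MeasurableSet B → Bornology.IsBounded B → ∃ n : ℕ, Φ ω B = n)
    (lam : ℝ) (hlam : 0 < lam)
    (hΦstat : ∀ v : E2, P.map (fun ω => (Φ ω).map (fun x => v + x)) = P.map Φ)
    (hΦint : ∀ B : Set E2, MeasurableSet B →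
      ∫⁻ ω, Φ ω B ∂P = ENNReal.ofReal lam * volume B)
    (hΦnu : ∀ B : Set E2, MeasurableSet B → Bornology.IsBounded B →
      P {ω | Φ ω B = 0} ≤ ENNReal.ofReal (Real.exp (-(∫⁻ ω, Φ ω B ∂P).toReal)))
    -- the interferers: an α-weakly sub-Poisson point process of intensity `μ > 0`
    (ΦI : Ω → Measure E2) (hΦImeas : Measurable ΦI)
    (hΦIcount : ∀ᵐ ω ∂P, ∀ B : Set E2,
      MeasurableSet B → Bornology.IsBounded B → ∃ n : ℕ, ΦI ω B = n)
    (hΦIsimple : ∀ᵐ ω ∂P, ∀ x, ΦI ω {x} ≤ 1)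
    (μ : ℝ) (hμ : 0 < μ)
    (hΦImean : ∀ B : Set E2, MeasurableSet B →
      ∫⁻ ω, ΦI ω B ∂P = ENNReal.ofReal μ * volume B)
    (hΦIsub : ∀ (k : ℕ) (B : Fin k → Set E2),
      (∀ i, MeasurableSet (B i) ∧ Bornology.IsBounded (B i)) →
      Pairwise (Function.onFun Disjoint B) →
      ∫⁻ ω, ∏ i, ΦI ω (B i) ∂P ≤ ∏ i, ∫⁻ ω, ΦI ω (B i) ∂P) :
    ∃ pw γ : ℝ, 0 < pw ∧ 0 < γ ∧
      0 < P {ω | GraphPercolates (atomsOf (Φ ω))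
        (fun X Y => X ≠ Y ∧ sinrGT l pw Nz T γ (ΦI ω) Y X ∧ sinrGT l pw Nz T γ (ΦI ω) X Y)} := by
  set s : ℝ := √(Real.log 1296 / lam) with hs_def
  have hlog : 0 < Real.log 1296 := Real.log_pos (by norm_num)
  have hs : 0 < s := Real.sqrt_pos.2 (by positivity)
  have hs2 : lam * s ^ 2 = Real.log 1296 := by
    rw [hs_def, Real.sq_sqrt (by positivity)]
    field_simp
  set a := cellWeight l s
  have ha : ∀ d, 0 < a d := fun d => hlpos _ (by positivity)
  have hsum : Summable a := summable_cellWeight hlanti hlpos hlint hs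
  have hA : 0 < ∑' d, a d := hsum.tsum_pos (fun d => (ha d).le) 0 (ha 0)
  set M : ℝ := (∑' d, a d) * (2 * μ * s ^ 2 + Real.log 1296) with hM_def
  have hM : 0 < M := by positivity
  have hr : ENNReal.ofReal (Real.exp (-Real.log 1296)) = (36⁻¹ : ℝ≥0∞) ^ 2 := by
    rw [Real.exp_neg, Real.exp_log (by norm_num), ENNReal.ofReal_inv_of_pos (by norm_num),
      ← ENNReal.inv_pow]
    norm_num
  have hempty : ∀ K : Finset (ℤ × ℤ), P {ω | ∀ i ∈ K, ω ∈ {ω | Φ ω (cell s i) = 0}} ≤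
      ((36⁻¹ : ℝ≥0∞) ^ 2) ^ K.card := fun K => by
    have h := measure_forall_cell_eq_zero_le hlam.le hΦint hΦnu hs K
    rwa [hs2, hr] at h
  have hinterf : ∀ K : Finset (ℤ × ℤ), P {ω | ∀ i ∈ K, ω ∈ {ω | ENNReal.ofReal M <
      ∑' j, ENNReal.ofReal (a (j - i)) * ΦI ω (cell s j)}} ≤
      ((36⁻¹ : ℝ≥0∞) ^ 2) ^ K.card := fun K => by
    have h := measure_forall_interference_gt_le hΦImeas hΦIcount hΦIsimple hμ.le hΦImean hΦIsub
      hs ha hsum M K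
    rwa [hM_def, mul_div_cancel_left₀ _ hA.ne', add_sub_cancel_left, hr] at h
  set bad : ℤ × ℤ → Set Ω := fun i => {ω | Φ ω (cell s i) = 0} ∪
    {ω | ENNReal.ofReal M < ∑' j, ENNReal.ofReal (a (j - i)) * ΦI ω (cell s j)}
  have hcluster := measure_originCluster_infinite_pos P bad (fun K => by
      have h := measure_forall_mem_union_le P _ _
        (ENNReal.inv_le_one.2 (by norm_num : (1 : ℝ≥0∞) ≤ 36)) hempty hinterf K
      have h18 : 2 * (36⁻¹ : ℝ≥0∞) = 18⁻¹ := by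
        rw [show (36 : ℝ≥0∞) = 2 * 18 by norm_num, ENNReal.mul_inv (by simp) (by simp),
          ← mul_assoc, ENNReal.mul_inv_cancel (by simp) (by simp), one_mul]
      rwa [h18] at h)
  have hl4 : 0 < l (2 * s * ((1 : ℤ) + 1)) := hlpos _ (by positivity)
  refine ⟨4 * T * Nz / l (2 * s * ((1 : ℤ) + 1)), l (2 * s * ((1 : ℤ) + 1)) / (4 * T * M),
    by positivity, by positivity, hcluster.trans_le (measure_mono_ae ?_)⟩
  filter_upwards [hΦcount] with ω hcount ⟨h0, hinf⟩
  refine graphPercolates_of_originCluster_infinite h0 hinf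
    (fun i hi => IsCounting.exists_atom hcount fun h => hi (Or.inl h)) ?_
  intro x y hne hx hy h1 h2
  have hI : ∀ z, ω ∉ bad (cellIndex s z) →
      ∫⁻ u, ENNReal.ofReal (l (dist u z)) ∂ΦI ω ≤ ENNReal.ofReal M := fun z hz =>
    (lintegral_attenuation_le hlanti hs (ΦI ω) (y := z) rfl).trans
      (not_lt.1 fun h => hz (Or.inr h))
  have hxy := dist_le_of_cellIndex hs 1 h1 h2
  exact ⟨hne, sinrGT_of_lintegral_le hlanti hNz hT (by positivity) hl4 hM
      (dist_comm x y ▸ hxy) (hI x hx),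
    sinrGT_of_lintegral_le hlanti hNz hT (by positivity) hl4 hM hxy (hI y hy)⟩
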